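/- Rothaus' lemma: for any probability measure μ, any bounded measurable function g and any real constant a, Ent_μ((g+a)²) ≤ Ent_μ(g²) + 2∫ g² dμ, where Ent_μ(h) = ∫ h log(h/∫h dμ) dμ for nonnegative h. -/

import Mathlib

open MeasureTheory

/-- Entropy of a nonnegative function `h` with respect to `μ`:
`Ent_μ(h) = ∫ h log h dμ − (∫ h dμ)·log(∫ h dμ)`. -/
noncomputable def entFun {α : Type*} [MeasurableSpace α] (μ : Measure α) (h : α → ℝ) : ℝ :=
  (∫ x, h x * Real.log (h x) ∂μ) - (∫ x, h x ∂μ) * Real.log (∫ x, h x ∂μ)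

open Filter Topology

section BoundedFunctions

variable {α : Type*} [MeasurableSpace α] {μ : Measure α} [IsFiniteMeasure μ] {g : α → ℝ} {C : ℝ}

theorem integrable_continuous_comp_of_bounded (hg : Measurable g) (hbd : ∀ x, |g x| ≤ C)
    {k : ℝ → ℝ} (hk : Continuous k) : Integrable (fun x => k (g x)) μ := by
  obtain ⟨M, hM⟩ := (isCompact_Icc (a := -C) (b := C)).exists_bound_of_continuousOn hk.continuousOn
  exact Integrable.of_bound (hk.measurable.comp hg).aestronglyMeasurable M
    (ae_of_all _ fun x => hM _ (abs_le.1 (hbd x)))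

theorem exists_bound_of_continuous_uncurry {F : ℝ → ℝ → ℝ} (hF : Continuous (Function.uncurry F))
    (C r : ℝ) : ∃ M, ∀ s ∈ Set.Icc (r - 1) (r + 1), ∀ y, |y| ≤ C → ‖F s y‖ ≤ M := by
  obtain ⟨M, hM⟩ := ((isCompact_Icc (a := r - 1) (b := r + 1)).prod
    (isCompact_Icc (a := -C) (b := C))).exists_bound_of_continuousOn hF.continuousOn
  exact ⟨M, fun s hs y hy => hM (s, y) ⟨hs, abs_le.1 hy⟩⟩

theorem continuous_integral_comp_of_bounded (hg : Measurable g) (hbd : ∀ x, |g x| ≤ C)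
    {F : ℝ → ℝ → ℝ} (hF : Continuous (Function.uncurry F)) :
    Continuous fun r => ∫ x, F r (g x) ∂μ := by
  refine continuous_iff_continuousAt.2 fun r => ?_
  obtain ⟨M, hM⟩ := exists_bound_of_continuous_uncurry hF C r
  have hnhds : Set.Icc (r - 1) (r + 1) ∈ 𝓝 r := Icc_mem_nhds (by linarith) (by linarith)
  refine tendsto_integral_filter_of_dominated_convergence (fun _ => M) ?_ ?_
    (integrable_const M) ?_
  · exact Eventually.of_forall fun s =>
      ((hF.uncurry_left s).measurable.comp hg).aestronglyMeasurable
  · filter_upwards [hnhds] with s hs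
    exact ae_of_all _ fun x => hM s hs _ (hbd x)
  · exact ae_of_all _ fun x => (hF.uncurry_right (g x)).continuousAt

theorem hasDerivAt_integral_comp_of_bounded (hg : Measurable g) (hbd : ∀ x, |g x| ≤ C)
    {F F' : ℝ → ℝ → ℝ} (hF : Continuous (Function.uncurry F))
    (hF' : Continuous (Function.uncurry F'))
    (h : ∀ r y, HasDerivAt (fun s => F s y) (F' r y) r) (r : ℝ) :
    HasDerivAt (fun s => ∫ x, F s (g x) ∂μ) (∫ x, F' r (g x) ∂μ) r := by
  obtain ⟨M, hM⟩ := exists_bound_of_continuous_uncurry hF' C r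
  refine (hasDerivAt_integral_of_dominated_loc_of_deriv_le (F := fun s x => F s (g x))
    (F' := fun s x => F' s (g x)) (s := Set.Icc (r - 1) (r + 1)) (bound := fun _ => M)
    (Icc_mem_nhds (by linarith) (by linarith)) ?_ ?_ ?_ ?_ (integrable_const M) ?_).2
  · exact Eventually.of_forall fun s =>
      ((hF.uncurry_left s).measurable.comp hg).aestronglyMeasurable
  · exact integrable_continuous_comp_of_bounded hg hbd (hF.uncurry_left r)
  · exact ((hF'.uncurry_left r).measurable.comp hg).aestronglyMeasurable
  · exact ae_of_all _ fun x s hs => hM s hs _ (hbd x)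
  · exact ae_of_all _ fun x s _ => h s (g x)

end BoundedFunctions

theorem mul_log_add_le_mul_log_add {s t : ℝ} (hs : 0 ≤ s) (ht : 0 < t) :
    s * Real.log t + s ≤ s * Real.log s + t := by
  rcases hs.eq_or_lt with rfl | hs
  · simpa using ht.le
  · have h := mul_le_mul_of_nonneg_left (Real.log_le_sub_one_of_pos (div_pos ht hs)) hs.le
    rw [Real.log_div ht.ne' hs.ne', mul_sub, mul_sub, mul_div_cancel₀ _ hs.ne'] at h
    linarith

theorem integral_mul_log_sub_le_entFun {α : Type*} [MeasurableSpace α] {μ : Measure α}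
    [NeZero μ] {s w : α → ℝ} (hs : 0 ≤ s) (hw : ∀ x, 0 < w x) (hsi : Integrable s μ)
    (hwi : Integrable w μ) (hsw : Integrable (fun x => s x * Real.log (w x)) μ)
    (hss : Integrable (fun x => s x * Real.log (s x)) μ) :
    ∫ x, s x * Real.log (w x) ∂μ - (∫ x, s x ∂μ) * Real.log (∫ x, w x ∂μ) ≤ entFun μ s := by
  unfold entFun
  have hA : 0 < ∫ x, w x ∂μ := by
    rw [integral_pos_iff_support_of_nonneg (fun x => (hw x).le) hwi]
    have : Function.support w = Set.univ := Set.eq_univ_of_forall fun x => (hw x).ne'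
    rw [this]
    exact NeZero.pos _
  rcases (integral_nonneg hs).eq_or_lt with hB | hB
  · have h0 : s =ᵐ[μ] 0 := (integral_eq_zero_iff_of_nonneg hs hsi).1 hB.symm
    have h1 : ∫ x, s x * Real.log (w x) ∂μ = ∫ x, s x * Real.log (s x) ∂μ :=
      integral_congr_ae (h0.mono fun x hx => by simp [hx])
    rw [h1, ← hB]
    simp
  · set A := ∫ x, w x ∂μ
    set B := ∫ x, s x ∂μ
    have hadd : Integrable (fun x => s x * Real.log (w x) +
        s x * (Real.log B - Real.log A)) μ := hsw.add (hsi.mul_const _)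
    have key : ∫ x, (s x * Real.log (w x) + s x * (Real.log B - Real.log A) + s x) ∂μ ≤
        ∫ x, (s x * Real.log (s x) + w x * (B / A)) ∂μ := by
      refine integral_mono (hadd.add hsi) (hss.add (hwi.mul_const _))
        fun x => ?_
      have h := mul_log_add_le_mul_log_add (hs x) (mul_pos (hw x) (div_pos hB hA))
      rw [Real.log_mul (hw x).ne' (div_pos hB hA).ne', Real.log_div hB.ne' hA.ne'] at h
      simp only
      linarith
    rw [integral_add hadd hsi, integral_add hsw (hsi.mul_const _),
      integral_add hss (hwi.mul_const _), integral_mul_const, integral_mul_const,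
      mul_div_cancel₀ _ hA.ne'] at key
    linarith

theorem le_mul_sq_of_second_deriv_le {K K' K'' : ℝ → ℝ} {D : ℝ} (hK : ∀ r, HasDerivAt K (K' r) r)
    (hK' : ∀ r, HasDerivAt K' (K'' r) r) (h : ∀ r, K'' r ≤ 2 * D) (h0 : K 0 = 0) (h0' : K' 0 = 0)
    {r : ℝ} (hr : 0 ≤ r) : K r ≤ D * r ^ 2 := by
  have h1 : ∀ s ∈ Set.Icc 0 r, K' s ≤ 2 * D * s :=
    image_le_of_deriv_right_le_deriv_boundary (B' := fun _ => 2 * D)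
      (fun s _ => (hK' s).continuousAt.continuousWithinAt)
      (fun s _ => (hK' s).hasDerivWithinAt) (by simp [h0']) (by fun_prop)
      (fun s _ => by simpa using ((hasDerivAt_id s).const_mul (2 * D)).hasDerivWithinAt)
      (fun s _ => h s)
  refine image_le_of_deriv_right_le_deriv_boundary (a := 0) (b := r) (f := K) (f' := K')
    (B := fun s => D * s ^ 2) (B' := fun s => 2 * D * s)
    (fun s _ => (hK s).continuousAt.continuousWithinAt)
    (fun s _ => (hK s).hasDerivWithinAt) (by simp [h0]) (by fun_prop)
    (fun s _ => ?_) (fun s hs => h1 s (Set.Ico_subset_Icc_self hs)) (Set.right_mem_Icc.2 hr)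
  refine (((hasDerivAt_pow 2 s).const_mul D).congr_deriv ?_).hasDerivWithinAt
  norm_num
  ring

theorem entFun_sq_add_pos_le {α : Type*} [MeasurableSpace α]
    (μ : Measure α) [IsProbabilityMeasure μ]
    (g : α → ℝ) (hg : Measurable g) (C : ℝ) (hbd : ∀ x, |g x| ≤ C) (a : ℝ) {ε : ℝ} (hε : 0 < ε) :
    entFun μ (fun x => (g x + a) ^ 2 + ε) ≤
      entFun μ (fun x => (g x) ^ 2) + 2 * ∫ x, (g x) ^ 2 ∂μ := by
  have hint : ∀ {k : ℝ → ℝ}, Continuous k → Integrable (fun x => k (g x)) μ :=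
    fun hk => integrable_continuous_comp_of_bounded hg hbd hk
  let W : ℝ → ℝ → ℝ := fun r y => (r * y + a) ^ 2 + ε
  let W' : ℝ → ℝ → ℝ := fun r y => 2 * y * (r * y + a)
  have hWpos : ∀ r y, 0 < W r y := fun r y => by positivity
  have hWne : ∀ p : ℝ × ℝ, W p.1 p.2 ≠ 0 := fun p => (hWpos _ _).ne'
  have hWc : Continuous fun p : ℝ × ℝ => W p.1 p.2 := by fun_prop
  have hW'c : Continuous fun p : ℝ × ℝ => W' p.1 p.2 := by fun_prop
  have hlogc : Continuous fun p : ℝ × ℝ => Real.log (W p.1 p.2) := hWc.log hWne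
  have hdW : ∀ r y, HasDerivAt (fun s => W s y) (W' r y) r := fun r y => by
    refine (((((hasDerivAt_id r).mul_const y).add_const a).pow 2).add_const ε).congr_deriv ?_
    simp [W']
    ring
  have hdW' : ∀ r y, HasDerivAt (fun s => W' s y) (2 * y ^ 2) r := fun r y => by
    refine ((((hasDerivAt_id r).mul_const y).add_const a).const_mul (2 * y)).congr_deriv ?_
    ring
  have hdlog : ∀ r y, HasDerivAt (fun s => Real.log (W s y)) (W' r y / W r y) r :=
    fun r y => (hdW r y).log (hWpos r y).ne'
  let A : ℝ → ℝ := fun r => ∫ x, W r (g x) ∂μ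
  let A' : ℝ → ℝ := fun r => ∫ x, W' r (g x) ∂μ
  let B : ℝ := ∫ x, (g x) ^ 2 ∂μ
  have hWi : ∀ r, Integrable (fun x => W r (g x)) μ := fun r => hint (by fun_prop)
  have hApos : ∀ r, 0 < A r := fun r => by
    have h : ∫ _, ε ∂μ ≤ A r := integral_mono (integrable_const ε) (hWi r) fun x => by
      simp only [W]
      nlinarith [sq_nonneg (r * g x + a)]
    simp only [integral_const, probReal_univ, one_smul] at h
    linarith
  have hdA : ∀ r, HasDerivAt A (A' r) r :=
    hasDerivAt_integral_comp_of_bounded hg hbd hWc hW'c hdW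
  have hdA' : ∀ r, HasDerivAt A' (2 * B) r := fun r => by
    have h := hasDerivAt_integral_comp_of_bounded (μ := μ) hg hbd (F := W')
      (F' := fun _ y => 2 * y ^ 2)
      hW'c (by fun_prop) hdW' r
    rwa [integral_const_mul] at h
  let I : ℝ → ℝ := fun r => ∫ x, W r (g x) * Real.log (W r (g x)) ∂μ
  let I' : ℝ → ℝ := fun r => ∫ x, W' r (g x) * (Real.log (W r (g x)) + 1) ∂μ
  let I'' : ℝ → ℝ := fun r => ∫ x, (2 * (g x) ^ 2 * (Real.log (W r (g x)) + 1) +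
    W' r (g x) * (W' r (g x) / W r (g x))) ∂μ
  have hI'c : Continuous fun p : ℝ × ℝ => W' p.1 p.2 * (Real.log (W p.1 p.2) + 1) :=
    hW'c.mul (hlogc.add continuous_const)
  have hI''c : Continuous fun p : ℝ × ℝ => 2 * p.2 ^ 2 * (Real.log (W p.1 p.2) + 1) +
      W' p.1 p.2 * (W' p.1 p.2 / W p.1 p.2) :=
    (((continuous_snd.pow 2).const_mul 2).mul (hlogc.add continuous_const)).add
      (hW'c.mul (hW'c.div hWc hWne))
  have hdI : ∀ r, HasDerivAt I (I' r) r :=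
    hasDerivAt_integral_comp_of_bounded hg hbd (F := fun r y => W r y * Real.log (W r y))
      (F' := fun r y => W' r y * (Real.log (W r y) + 1)) (hWc.mul hlogc) hI'c fun r y => by
      refine ((hdW r y).mul (hdlog r y)).congr_deriv ?_
      rw [mul_div_cancel₀ _ (hWpos r y).ne']
      ring
  have hdI' : ∀ r, HasDerivAt I' (I'' r) r :=
    hasDerivAt_integral_comp_of_bounded hg hbd
      (F := fun r y => W' r y * (Real.log (W r y) + 1))
      (F' := fun r y => 2 * y ^ 2 * (Real.log (W r y) + 1) + W' r y * (W' r y / W r y))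
      hI'c hI''c fun r y => (hdW' r y).mul ((hdlog r y).add_const 1)
  have hI''le : ∀ r, I'' r ≤ 2 * ∫ x, (g x) ^ 2 * Real.log (W r (g x)) ∂μ + 6 * B := fun r => by
    have hi : Integrable (fun x => (g x) ^ 2 * Real.log (W r (g x))) μ :=
      hint (k := fun y => y ^ 2 * Real.log (W r y))
        ((continuous_pow 2).mul (hlogc.comp (Continuous.prodMk_right r)))
    have hi2 : Integrable (fun x => (g x) ^ 2) μ := hint (continuous_pow 2)
    rw [← integral_const_mul, ← integral_const_mul,
      ← integral_add (hi.const_mul 2) (hi2.const_mul 6)]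
    refine integral_mono (hint (hI''c.comp (Continuous.prodMk_right r)))
      ((hi.const_mul 2).add (hi2.const_mul 6)) fun x => ?_
    have h : W' r (g x) * (W' r (g x) / W r (g x)) ≤ 4 * (g x) ^ 2 := by
      rw [← mul_div_assoc, div_le_iff₀ (hWpos _ _)]
      simp only [W, W']
      nlinarith [mul_nonneg hε.le (sq_nonneg (g x))]
    simp only
    linarith
  have hgibbs : ∀ r, ∫ x, (g x) ^ 2 * Real.log (W r (g x)) ∂μ - B * Real.log (A r) ≤
      entFun μ (fun x => (g x) ^ 2) := fun r =>
    integral_mul_log_sub_le_entFun (fun x => sq_nonneg (g x)) (fun x => hWpos r (g x))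
      (hint (continuous_pow 2)) (hWi r)
      (hint (k := fun y => y ^ 2 * Real.log (W r y))
        ((continuous_pow 2).mul (hlogc.comp (Continuous.prodMk_right r))))
      (hint (Real.continuous_mul_log.comp (continuous_pow 2)))
  have key := le_mul_sq_of_second_deriv_le (r := 1)
    (D := entFun μ (fun x => (g x) ^ 2) + 2 * B)
    (K := fun r => I r - A r * Real.log (A r))
    (K' := fun r => I' r - A' r * (Real.log (A r) + 1))
    (K'' := fun r => I'' r - (2 * B * (Real.log (A r) + 1) + A' r * (A' r / A r)))
    (fun r => by
      refine ((hdI r).sub ((hdA r).mul ((hdA r).log (hApos r).ne'))).congr_deriv ?_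
      rw [mul_div_cancel₀ _ (hApos r).ne']
      ring)
    (fun r => (hdI' r).sub ((hdA' r).mul (((hdA r).log (hApos r).ne').add_const 1)))
    (fun r => by
      have h1 := hI''le r
      have h2 := hgibbs r
      have h3 : 0 ≤ A' r * (A' r / A r) := by
        rw [← mul_div_assoc]
        exact div_nonneg (mul_self_nonneg _) (hApos r).le
      linarith)
    (by simp [I, A, W])
    (by simp [I', A', A, W, W', integral_mul_const])
    zero_le_one
  simpa [entFun, I, A, W, B] using key

theorem stmt_8 {α : Type*} [MeasurableSpace α]
    (μ : Measure α) [IsProbabilityMeasure μ]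
    (g : α → ℝ) (hg : Measurable g) (C : ℝ) (hbd : ∀ x, |g x| ≤ C) (a : ℝ) :
    entFun μ (fun x => (g x + a) ^ 2) ≤
      entFun μ (fun x => (g x) ^ 2) + 2 * ∫ x, (g x) ^ 2 ∂μ := by
  have hW : Continuous (Function.uncurry fun ε y : ℝ => (y + a) ^ 2 + ε) := by fun_prop
  have hcont : Continuous fun ε : ℝ => entFun μ (fun x => (g x + a) ^ 2 + ε) :=
    (continuous_integral_comp_of_bounded hg hbd
      (F := fun ε y => ((y + a) ^ 2 + ε) * Real.log ((y + a) ^ 2 + ε))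
      (Real.continuous_mul_log.comp hW)).sub
      (Real.continuous_mul_log.comp (continuous_integral_comp_of_bounded hg hbd hW))
  have hlim := (hcont.tendsto 0).mono_left (nhdsWithin_le_nhds (s := Set.Ioi 0))
  simp only [add_zero] at hlim
  refine le_of_tendsto hlim ?_
  filter_upwards [self_mem_nhdsWithin] with ε hε
  exact entFun_sq_add_pos_le μ g hg C hbd a hε
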